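/- Let 𝔻̄ be the closed unit disk in ℝ², let c ∈ ℝ and let γ ∈ ℝ with γ² < 2. Then for every continuous centered Gaussian field Γ on 𝔻̄ whose covariance kernel C satisfies C(z,w) ≤ −log|z−w| + c for all z ≠ w in 𝔻̄, one has E[M^γ(Γ, 𝔻̄)²] ≤ e^{γ²c} ∫_{𝔻̄}∫_{𝔻̄} |z−w|^{−γ²} dz dw < ∞. In particular the second moment is bounded uniformly over all such fields with the same constant c. -/

import Mathlib

open MeasureTheory ProbabilityTheory Real

/-- A continuous centered Gaussian field on a set `K ⊂ ℝ²` (modelled by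
`EuclideanSpace ℝ (Fin 2)`), with covariance kernel `C`. -/
def IsContGaussianField {Ω : Type*} [MeasureSpace Ω]
    (K : Set (EuclideanSpace ℝ (Fin 2)))
    (Γ : Ω → EuclideanSpace ℝ (Fin 2) → ℝ)
    (C : EuclideanSpace ℝ (Fin 2) → EuclideanSpace ℝ (Fin 2) → ℝ) : Prop :=
  Measurable (Function.uncurry Γ) ∧
  (∀ᵐ ω ∂(ℙ : Measure Ω), ContinuousOn (Γ ω) K) ∧
  (∀ (n : ℕ) (a : Fin n → ℝ) (z : Fin n → EuclideanSpace ℝ (Fin 2)), (∀ j, z j ∈ K) →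
    ∃ v : NNReal,
      Measure.map (fun ω => ∑ j, a j * Γ ω (z j)) (ℙ : Measure Ω) = gaussianReal 0 v) ∧
  (∀ z ∈ K, ∀ w ∈ K, C z w = ∫ ω, Γ ω z * Γ ω w) ∧
  ContinuousOn (fun p : EuclideanSpace ℝ (Fin 2) × EuclideanSpace ℝ (Fin 2) => C p.1 p.2)
    (K ×ˢ K)

/-- The total mass `M^γ(Γ, 𝔻̄) = ∫ exp(γ Γ(z) − (γ²/2) C(z,z)) dz` of the approximate GMC
measure of a sample path `g = Γ(ω, ·)` over the closed unit disk. -/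
noncomputable def gmcMass (K : Set (EuclideanSpace ℝ (Fin 2))) (γ : ℝ)
    (C : EuclideanSpace ℝ (Fin 2) → EuclideanSpace ℝ (Fin 2) → ℝ)
    (g : EuclideanSpace ℝ (Fin 2) → ℝ) : ℝ :=
  ∫ z in K, Real.exp (γ * g z - γ ^ 2 / 2 * C z z)

/-- Second exponential moment of a Gaussian pair, normalised as in the definition of Gaussian
multiplicative chaos. -/
lemma lintegral_wick_exp_mul_wick_exp {Ω : Type*} [MeasurableSpace Ω] {μ : Measure Ω}
    [IsProbabilityMeasure μ] {X Y : Ω → ℝ} {u v s : NNReal}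
    (hX : μ.map X = gaussianReal 0 u) (hY : μ.map Y = gaussianReal 0 v)
    (hXY : μ.map (fun ω => X ω + Y ω) = gaussianReal 0 s) (γ : ℝ) :
    ∫⁻ ω, ENNReal.ofReal (exp (γ * X ω - γ ^ 2 / 2 * ∫ ω, X ω * X ω ∂μ)) *
        ENNReal.ofReal (exp (γ * Y ω - γ ^ 2 / 2 * ∫ ω, Y ω * Y ω ∂μ)) ∂μ =
      ENNReal.ofReal (exp (γ ^ 2 * ∫ ω, X ω * Y ω ∂μ)) := by
  have meas {Z : Ω → ℝ} {t : NNReal} (h : μ.map Z = gaussianReal 0 t) : AEMeasurable Z μ :=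
    aemeasurable_of_map_neZero (by rw [h]; infer_instance)
  have memLp {Z : Ω → ℝ} {t : NNReal} (h : μ.map Z = gaussianReal 0 t) : MemLp Z 2 μ := by
    have : MemLp id 2 (μ.map Z) := by
      rw [h]
      exact memLp_id_gaussianReal' 2 (by simp)
    exact (memLp_map_measure_iff aestronglyMeasurable_id (meas h)).1 this
  have second {Z : Ω → ℝ} {t : NNReal} (h : μ.map Z = gaussianReal 0 t) :
      ∫ ω, Z ω * Z ω ∂μ = t := by
    have hmean : ∫ ω, Z ω ∂μ = 0 := by
      have := integral_map (meas h) (f := id) aestronglyMeasurable_id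
      rw [h] at this
      simpa using this.symm
    have hvar : Var[Z; μ] = t := by
      have := variance_map (X := id) aemeasurable_id (meas h)
      rw [h, variance_id_gaussianReal] at this
      simpa using this.symm
    rw [variance_of_integral_eq_zero (meas h) hmean] at hvar
    simpa [sq] using hvar
  have hs : (s : ℝ) = u + 2 * (∫ ω, X ω * Y ω ∂μ) + v := by
    have hXX : Integrable (fun ω => X ω * X ω) μ := (memLp hX).integrable_mul (memLp hX)
    have hXY' : Integrable (fun ω => X ω * Y ω) μ := (memLp hX).integrable_mul (memLp hY)
    have hYY : Integrable (fun ω => Y ω * Y ω) μ := (memLp hY).integrable_mul (memLp hY)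
    rw [← second hX, ← second hY, ← second hXY, ← integral_const_mul,
      ← integral_add hXX (hXY'.const_mul 2), ← integral_add (by fun_prop) hYY]
    congr 1 with ω
    ring
  have hintegrable : Integrable (fun ω => exp (γ * (X ω + Y ω))) μ := by
    have : Integrable (fun x => exp (γ * x)) (μ.map fun ω => X ω + Y ω) := by
      rw [hXY]
      exact integrable_exp_mul_gaussianReal γ
    exact (integrable_map_measure (by fun_prop) (meas hXY)).1 this
  have hmgf : ∫ ω, exp (γ * (X ω + Y ω)) ∂μ = exp (s * γ ^ 2 / 2) := by
    simpa [mgf] using mgf_gaussianReal hXY γ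
  have hfact (ω : Ω) : exp (γ * X ω - γ ^ 2 / 2 * u) * exp (γ * Y ω - γ ^ 2 / 2 * v) =
      exp (-(γ ^ 2 / 2 * (u + v))) * exp (γ * (X ω + Y ω)) := by
    rw [← exp_add, ← exp_add]
    congr 1
    ring
  rw [second hX, second hY]
  simp_rw [← ENNReal.ofReal_mul (exp_nonneg _), hfact]
  rw [← ofReal_integral_eq_lintegral_ofReal (hintegrable.const_mul _)
    (.of_forall fun ω => by positivity), integral_const_mul, hmgf, ← exp_add, hs]
  congr 2
  ring

/-- The second moment of a random total mass is the double integral of the two-point function. -/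
lemma lintegral_sq_lintegral {Ω E : Type*} [MeasurableSpace Ω] [MeasurableSpace E]
    {μ : Measure Ω} {ν : Measure E} [SFinite μ] [SFinite ν] {F : Ω → E → ENNReal}
    (hF : Measurable (Function.uncurry F)) :
    ∫⁻ ω, (∫⁻ z, F ω z ∂ν) ^ 2 ∂μ = ∫⁻ z, ∫⁻ w, ∫⁻ ω, F ω z * F ω w ∂μ ∂ν ∂ν := by
  have hF' (ω : Ω) : Measurable (F ω) := hF.of_uncurry_left
  have hI : Measurable fun ω => ∫⁻ w, F ω w ∂ν := hF.lintegral_prod_right'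
  calc ∫⁻ ω, (∫⁻ z, F ω z ∂ν) ^ 2 ∂μ
      = ∫⁻ ω, ∫⁻ z, F ω z * ∫⁻ w, F ω w ∂ν ∂ν ∂μ := by
        congr 1 with ω
        rw [lintegral_mul_const _ (hF' ω), sq]
    _ = ∫⁻ z, ∫⁻ ω, F ω z * ∫⁻ w, F ω w ∂ν ∂μ ∂ν :=
        lintegral_lintegral_swap (hF.mul (hI.comp measurable_fst)).aemeasurable
    _ = ∫⁻ z, ∫⁻ ω, ∫⁻ w, F ω z * F ω w ∂ν ∂μ ∂ν := by
        congr 1 with z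
        congr 1 with ω
        rw [lintegral_const_mul _ (hF' ω)]
    _ = ∫⁻ z, ∫⁻ w, ∫⁻ ω, F ω z * F ω w ∂μ ∂ν ∂ν := by
        congr 1 with z
        refine lintegral_lintegral_swap (Measurable.aemeasurable ?_)
        exact (hF.comp (measurable_fst.prodMk measurable_const)).mul hF

/-- The Riesz energy of a ball is finite below the dimension. -/
lemma lintegral_lintegral_dist_rpow_neg_lt_top {E : Type*} [NormedAddCommGroup E]
    [NormedSpace ℝ E] [FiniteDimensional ℝ E] [MeasurableSpace E] [BorelSpace E]
    (μ : Measure E) [μ.IsAddHaarMeasure] (hd : 1 ≤ Module.finrank ℝ E) {α : ℝ}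
    (hα : α < Module.finrank ℝ E) (r : ℝ) :
    ∫⁻ z in Metric.closedBall (0 : E) r, ∫⁻ w in Metric.closedBall (0 : E) r,
      ENNReal.ofReal (dist z w ^ (-α)) ∂μ ∂μ < ⊤ := by
  set B := Metric.ball (0 : E) (2 * r + 1)
  have hintegrable : IntegrableOn (fun x : E => ‖x‖ ^ (-α)) B μ :=
    integrableOn_ball_of_norm_le_rpow (C := 1) hd hα
      (.of_forall fun x => by simp [abs_of_nonneg (rpow_nonneg (norm_nonneg x) _)])
      (measurable_norm.pow_const _).aestronglyMeasurable
  have hfin : ∫⁻ x in B, ENNReal.ofReal (‖x‖ ^ (-α)) ∂μ < ⊤ := hintegrable.lintegral_lt_top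
  have hbound : ∀ z ∈ Metric.closedBall (0 : E) r,
      ∫⁻ w in Metric.closedBall (0 : E) r, ENNReal.ofReal (dist z w ^ (-α)) ∂μ ≤
        ∫⁻ x in B, ENNReal.ofReal (‖x‖ ^ (-α)) ∂μ := by
    intro z hz
    rw [← lintegral_indicator Metric.isClosed_closedBall.measurableSet,
      ← lintegral_indicator Metric.isOpen_ball.measurableSet,
      ← lintegral_sub_right_eq_self (B.indicator _) z]
    refine lintegral_mono fun w => ?_
    by_cases hw : w ∈ Metric.closedBall (0 : E) r
    · have hwz : w - z ∈ B := by
        rw [mem_closedBall_zero_iff] at hz hw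
        rw [mem_ball_zero_iff]
        linarith [norm_sub_le w z]
      simp [Set.indicator_of_mem hw, Set.indicator_of_mem hwz, dist_eq_norm, norm_sub_rev z w]
    · simp [Set.indicator_of_notMem hw]
  calc _ ≤ ∫⁻ _ in Metric.closedBall (0 : E) r, ∫⁻ x in B, ENNReal.ofReal (‖x‖ ^ (-α)) ∂μ ∂μ :=
        setLIntegral_mono measurable_const hbound
    _ = (∫⁻ x in B, ENNReal.ofReal (‖x‖ ^ (-α)) ∂μ) * μ (Metric.closedBall 0 r) :=
        setLIntegral_const _ _
    _ < ⊤ := ENNReal.mul_lt_top hfin measure_closedBall_lt_top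

/-- **Uniform second moment bound in the `L²` regime.** Let `𝔻̄` be the closed unit disk,
`c ∈ ℝ` and `γ² < 2`. For every continuous centered Gaussian field `Γ` on `𝔻̄` whose covariance
kernel satisfies `C(z,w) ≤ −log|z−w| + c` off the diagonal, one has
`E[M^γ(Γ,𝔻̄)²] ≤ e^{γ²c} ∫∫ |z−w|^{−γ²} dz dw < ∞`; in particular the second moment is
bounded uniformly over all such fields. -/
theorem gmc_second_moment_bound
    (c γ : ℝ) (hγ : γ ^ 2 < 2)
    {Ω : Type*} [MeasureSpace Ω] [IsProbabilityMeasure (ℙ : Measure Ω)]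
    (Γ : Ω → EuclideanSpace ℝ (Fin 2) → ℝ)
    (C : EuclideanSpace ℝ (Fin 2) → EuclideanSpace ℝ (Fin 2) → ℝ)
    (hfield : IsContGaussianField (Metric.closedBall (0 : EuclideanSpace ℝ (Fin 2)) 1) Γ C)
    (hcov : ∀ z ∈ Metric.closedBall (0 : EuclideanSpace ℝ (Fin 2)) 1,
      ∀ w ∈ Metric.closedBall (0 : EuclideanSpace ℝ (Fin 2)) 1,
      z ≠ w → C z w ≤ -Real.log (dist z w) + c) :
    (∫⁻ ω, ENNReal.ofReal
        ((gmcMass (Metric.closedBall (0 : EuclideanSpace ℝ (Fin 2)) 1) γ C (Γ ω)) ^ 2)) ≤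
      ENNReal.ofReal (Real.exp (γ ^ 2 * c)) *
        (∫⁻ z in Metric.closedBall (0 : EuclideanSpace ℝ (Fin 2)) 1,
          ∫⁻ w in Metric.closedBall (0 : EuclideanSpace ℝ (Fin 2)) 1,
            ENNReal.ofReal (dist z w ^ (-(γ ^ 2)))) ∧
    (∫⁻ z in Metric.closedBall (0 : EuclideanSpace ℝ (Fin 2)) 1,
      ∫⁻ w in Metric.closedBall (0 : EuclideanSpace ℝ (Fin 2)) 1,
        ENNReal.ofReal (dist z w ^ (-(γ ^ 2)))) < ⊤ := by
  refine ⟨?_, lintegral_lintegral_dist_rpow_neg_lt_top volume (by simp) (by simpa using hγ) 1⟩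
  set K := Metric.closedBall (0 : EuclideanSpace ℝ (Fin 2)) 1
  have hK : MeasurableSet K := Metric.isClosed_closedBall.measurableSet
  obtain ⟨hmeas, -, hgauss, hC, hcont⟩ := hfield
  set D : EuclideanSpace ℝ (Fin 2) → ℝ := K.indicator fun z => C z z
  have hD : Measurable D := by
    have hdiag : ContinuousOn (fun z => C z z) K :=
      hcont.comp (f := fun z => (z, z)) (by fun_prop) fun z hz => ⟨hz, hz⟩
    classical
    have := hdiag.measurable_piecewise (g := 0) continuousOn_const hK
    rwa [Set.piecewise_eq_indicator] at this
  have hDK {z} (hz : z ∈ K) : D z = C z z := Set.indicator_of_mem hz _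
  set F : Ω → EuclideanSpace ℝ (Fin 2) → ENNReal := fun ω z =>
    ENNReal.ofReal (exp (γ * Γ ω z - γ ^ 2 / 2 * D z))
  have hF : Measurable (Function.uncurry F) :=
    ENNReal.measurable_ofReal.comp <| measurable_exp.comp <|
      (hmeas.const_mul γ).sub ((hD.comp measurable_snd).const_mul _)
  have hmass (ω : Ω) : ENNReal.ofReal (gmcMass K γ C (Γ ω) ^ 2) ≤ (∫⁻ z in K, F ω z) ^ 2 := by
    have hnonneg : 0 ≤ gmcMass K γ C (Γ ω) := integral_nonneg fun z => exp_nonneg _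
    rw [ENNReal.ofReal_pow hnonneg, ← Real.enorm_of_nonneg hnonneg]
    gcongr
    refine (enorm_integral_le_lintegral_enorm _).trans_eq (setLIntegral_congr_fun hK fun z hz => ?_)
    simp only [F, hDK hz, Real.enorm_of_nonneg (exp_nonneg _)]
  have hlaw {z} (hz : z ∈ K) : ∃ v : NNReal,
      Measure.map (fun ω => Γ ω z) (ℙ : Measure Ω) = gaussianReal 0 v := by
    simpa using hgauss 1 (fun _ => 1) (fun _ => z) fun _ => hz
  have hlaw_add {z w} (hz : z ∈ K) (hw : w ∈ K) : ∃ v : NNReal,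
      Measure.map (fun ω => Γ ω z + Γ ω w) (ℙ : Measure Ω) = gaussianReal 0 v := by
    simpa [Fin.sum_univ_two] using hgauss 2 (fun _ => 1) ![z, w]
      (by simp [Fin.forall_fin_two, hz, hw])
  have htwo {z w} (hz : z ∈ K) (hw : w ∈ K) :
      ∫⁻ ω, F ω z * F ω w = ENNReal.ofReal (exp (γ ^ 2 * C z w)) := by
    obtain ⟨u, hu⟩ := hlaw hz
    obtain ⟨v, hv⟩ := hlaw hw
    obtain ⟨s, hs⟩ := hlaw_add hz hw
    simp only [F, hDK hz, hDK hw, hC z hz z hz, hC w hw w hw, hC z hz w hw]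
    exact lintegral_wick_exp_mul_wick_exp hu hv hs γ
  have hexp {z w} (hz : z ∈ K) (hw : w ∈ K) (hzw : z ≠ w) :
      exp (γ ^ 2 * C z w) ≤ exp (γ ^ 2 * c) * dist z w ^ (-(γ ^ 2)) := by
    rw [rpow_def_of_pos (dist_pos.2 hzw), ← exp_add, exp_le_exp]
    linarith [mul_le_mul_of_nonneg_left (hcov z hz w hw hzw) (sq_nonneg γ)]
  calc _ ≤ ∫⁻ ω, (∫⁻ z in K, F ω z) ^ 2 := lintegral_mono hmass
    _ = ∫⁻ z in K, ∫⁻ w in K, ∫⁻ ω, F ω z * F ω w := lintegral_sq_lintegral hF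
    _ ≤ ∫⁻ z in K, ENNReal.ofReal (exp (γ ^ 2 * c)) *
          ∫⁻ w in K, ENNReal.ofReal (dist z w ^ (-(γ ^ 2))) := by
        refine lintegral_mono_ae ((ae_restrict_iff' hK).2 (.of_forall fun z hz => ?_))
        rw [← lintegral_const_mul' _ _ ENNReal.ofReal_ne_top]
        refine lintegral_mono_ae ((ae_restrict_iff' hK).2 ?_)
        filter_upwards [compl_mem_ae_iff.2 (measure_singleton z)] with w hwz hw
        rw [htwo hz hw, ← ENNReal.ofReal_mul (exp_nonneg _)]
        exact ENNReal.ofReal_le_ofReal (hexp hz hw (Ne.symm hwz))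
    _ = _ := lintegral_const_mul' _ _ ENNReal.ofReal_ne_top
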